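/- arXiv:math/0503674 — 4 statements merged into one kernel-verified Lean document; each statement's English description precedes it below -/
import Mathlib

section
/- There exists a universal constant C < ∞ such that for every λ > 0 and every μ ∈ ℝ, H²(g̃_λ, φ_μ) ≤ C/λ + (2√λ − μ)²/2, where g̃_λ is the density of 2·sgn(X_λ + U)·√|X_λ + U| for X_λ ~ Poisson(λ) and independent U ~ Uniform[−1/2, 1/2), and φ_μ is the density of N(μ, 1). -/
open MeasureTheory

/-- The law of `X_λ + U` where `X_λ ~ Poisson(λ)` and `U ~ Uniform[-1/2, 1/2)`
is independent of `X_λ`: the measure with density `e^{-λ} λ^j / j!` on `[j - 1/2, j + 1/2)`. -/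
noncomputable def poissonUnifLaw (lam : ℝ) : Measure ℝ :=
  Measure.sum fun j : ℕ =>
    ENNReal.ofReal (Real.exp (-lam) * lam ^ j / (Nat.factorial j)) •
      (volume.restrict (Set.Ico ((j : ℝ) - 1 / 2) ((j : ℝ) + 1 / 2)))

/-- The transformation `x ↦ 2 · sgn(x) · √|x|`. -/
noncomputable def sqrtTransform (x : ℝ) : ℝ := 2 * Real.sign x * Real.sqrt |x|

/-- `g̃_λ`, the (Lebesgue) density of `Z̃_λ = 2 · sgn(X_λ + U) · √|X_λ + U|`. -/
noncomputable def poissonGtilde (lam : ℝ) (z : ℝ) : ℝ :=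
  (((poissonUnifLaw lam).map sqrtTransform).rnDeriv volume z).toReal

/-- `φ_μ`, the density of the normal distribution `N(μ, 1)`. -/
noncomputable def gaussPdf (μ z : ℝ) : ℝ :=
  (Real.sqrt (2 * Real.pi))⁻¹ * Real.exp (-((z - μ) ^ 2) / 2)

/-- The squared Hellinger distance `H²(f, g) = ∫ (√f − √g)²` between densities on `ℝ`. -/
noncomputable def Hsq (f g : ℝ → ℝ) : ℝ :=
  ∫ z : ℝ, (Real.sqrt (f z) - Real.sqrt (g z)) ^ 2
theorem monotoneOn_log_sub_quadratic :
    MonotoneOn (fun t : ℝ => Real.log t - (t - 1) + (t - 1) ^ 2 / 2) (Set.Ioi 0) := by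
  have hd : ∀ t ∈ Set.Ioi (0 : ℝ), HasDerivAt
      (fun t : ℝ => Real.log t - (t - 1) + (t - 1) ^ 2 / 2) ((t - 1) ^ 2 / t) t := by
    intro t ht
    have ht' : t ≠ 0 := ne_of_gt ht
    have := ((Real.hasDerivAt_log ht').sub ((hasDerivAt_id t).sub_const 1)).add
      ((((hasDerivAt_id t).sub_const 1).pow 2).div_const 2)
    refine this.congr_deriv ?_
    simp only [id_eq]
    field_simp
    ring
  refine monotoneOn_of_deriv_nonneg (convex_Ioi 0)
    (fun t ht => (hd t ht).continuousAt.continuousWithinAt) ?_ ?_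
  · rw [interior_Ioi]
    exact fun t ht => (hd t ht).differentiableAt.differentiableWithinAt
  · rw [interior_Ioi]
    intro t ht
    rw [(hd t ht).deriv]
    have : 0 < t := ht
    positivity

theorem cubic_le_mul_log {t : ℝ} (ht : 0 < t) :
    (t - 1) + (t - 1) ^ 2 / 2 - (t - 1) ^ 3 / 6 ≤ t * Real.log t := by
  set h : ℝ → ℝ := fun t => t * Real.log t - ((t - 1) + (t - 1) ^ 2 / 2 - (t - 1) ^ 3 / 6) with hh
  have hd : ∀ t : ℝ, 0 < t → HasDerivAt h (Real.log t - (t - 1) + (t - 1) ^ 2 / 2) t := by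
    intro t ht
    have h1 := (hasDerivAt_id t).sub_const 1
    have := (Real.hasDerivAt_mul_log ht.ne').sub
      ((h1.add ((h1.pow 2).div_const 2)).sub ((h1.pow 3).div_const 6))
    refine this.congr_deriv ?_
    simp only [id_eq]
    ring
  suffices 0 ≤ h t by simpa [hh] using this
  have h1 : h 1 = 0 := by simp [hh]
  rw [← h1]
  rcases le_total t 1 with h01 | h10
  · refine antitoneOn_of_deriv_nonpos (convex_Ioc 0 1)
      (fun s hs => (hd s hs.1).continuousAt.continuousWithinAt) ?_ ?_ ⟨ht, h01⟩ ⟨one_pos, le_rfl⟩ h01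
    · rw [interior_Ioc]
      exact fun s hs => (hd s hs.1).differentiableAt.differentiableWithinAt
    · rw [interior_Ioc]
      intro s hs
      rw [(hd s hs.1).deriv]
      simpa using monotoneOn_log_sub_quadratic hs.1 (Set.mem_Ioi.2 one_pos) hs.2.le
  · refine monotoneOn_of_deriv_nonneg (convex_Ici 1)
      (fun s hs => (hd s (one_pos.trans_le hs)).continuousAt.continuousWithinAt) ?_ ?_
      (Set.mem_Ici.2 le_rfl) h10 h10
    · rw [interior_Ici]
      exact fun s hs => (hd s (one_pos.trans hs)).differentiableAt.differentiableWithinAt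
    · rw [interior_Ici]
      intro s hs
      rw [(hd s (one_pos.trans hs)).deriv]
      simpa using monotoneOn_log_sub_quadratic (Set.mem_Ioi.2 one_pos)
        (Set.mem_Ioi.2 (one_pos.trans hs)) (le_of_lt hs)

theorem quartic_le_sqrt {t : ℝ} (ht : 0 ≤ t) :
    1 + (t - 1) / 2 - (t - 1) ^ 2 / 8 + (t - 1) ^ 3 / 16 - (t - 1) ^ 4 ≤ Real.sqrt t := by
  obtain ⟨s, hs, rfl⟩ : ∃ s : ℝ, 0 ≤ s ∧ t = s ^ 2 :=
    ⟨Real.sqrt t, Real.sqrt_nonneg t, (Real.sq_sqrt ht).symm⟩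
  rw [Real.sqrt_sq hs, ← sub_nonneg]
  have : s - (1 + (s ^ 2 - 1) / 2 - (s ^ 2 - 1) ^ 2 / 8 + (s ^ 2 - 1) ^ 3 / 16 - (s ^ 2 - 1) ^ 4)
      = (s - 1) ^ 4 * (11 / 16 + 15 / 4 * s + 95 / 16 * s ^ 2 + 4 * s ^ 3 + s ^ 4) := by ring
  rw [this]
  positivity

theorem quadratic_le_sqrt {s : ℝ} (hs : -1 ≤ s) :
    1 + s / 2 - s ^ 2 / 2 ≤ Real.sqrt (1 + s) := by
  rcases le_total s 2 with h | h
  · apply Real.le_sqrt_of_sq_le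
    nlinarith [mul_nonneg (mul_nonneg (sq_nonneg s) (sub_nonneg.2 hs)) (by linarith : 0 ≤ 3 - s)]
  · exact le_trans (by nlinarith) (Real.sqrt_nonneg _)

/-- The Poisson probability mass function. -/
noncomputable def poissonWeight (lam : ℝ) (j : ℕ) : ℝ :=
  Real.exp (-lam) * lam ^ j / (Nat.factorial j)

theorem poissonWeight_pos {lam : ℝ} (hl : 0 < lam) (j : ℕ) : 0 < poissonWeight lam j := by
  unfold poissonWeight; positivity

theorem hasSum_poissonWeight {lam : ℝ} (hl : 0 < lam) : HasSum (poissonWeight lam) 1 :=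
  ProbabilityTheory.hasSum_one_poissonMeasure ⟨lam, hl.le⟩

theorem succ_mul_poissonWeight_succ (lam : ℝ) (j : ℕ) :
    ((j : ℝ) + 1) * poissonWeight lam (j + 1) = lam * poissonWeight lam j := by
  unfold poissonWeight
  rw [Nat.factorial_succ]
  push_cast
  field_simp
  ring

theorem HasSum.of_eq {f g : ℕ → ℝ} {a b : ℝ} (h : HasSum f a) (hfg : ∀ j, f j = g j)
    (hab : a = b) : HasSum g b :=
  hab ▸ funext hfg ▸ h

theorem HasSum.poissonWeight_mul_shift {lam : ℝ} {f : ℕ → ℝ} {s : ℝ}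
    (h : HasSum (fun j => poissonWeight lam j * f (j + 1)) s) :
    HasSum (fun j => poissonWeight lam j * (j * f j)) (lam * s) := by
  rw [← hasSum_nat_add_iff' 1]
  simp only [Finset.range_one, Finset.sum_singleton, Nat.cast_zero, zero_mul, mul_zero, sub_zero]
  refine (h.mul_left lam).of_eq (fun j => ?_) rfl
  rw [← mul_assoc lam, ← succ_mul_poissonWeight_succ]
  push_cast
  ring

theorem hasSum_poissonWeight_mul_id {lam : ℝ} (hl : 0 < lam) :
    HasSum (fun j : ℕ => poissonWeight lam j * j) lam :=
  (HasSum.poissonWeight_mul_shift (f := fun _ => 1) (by simpa using hasSum_poissonWeight hl)).of_eq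
    (fun j => by ring) (by ring)

theorem hasSum_poissonWeight_mul_sq {lam : ℝ} (hl : 0 < lam) :
    HasSum (fun j : ℕ => poissonWeight lam j * j ^ 2) (lam ^ 2 + lam) :=
  (HasSum.poissonWeight_mul_shift (f := fun j => (j : ℝ))
    (((hasSum_poissonWeight_mul_id hl).add (hasSum_poissonWeight hl)).of_eq
      (fun j => by push_cast; ring) rfl)).of_eq (fun j => by ring) (by ring)

theorem hasSum_poissonWeight_mul_cube {lam : ℝ} (hl : 0 < lam) :
    HasSum (fun j : ℕ => poissonWeight lam j * j ^ 3) (lam ^ 3 + 3 * lam ^ 2 + lam) :=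
  (HasSum.poissonWeight_mul_shift (f := fun j => (j : ℝ) ^ 2)
    ((((hasSum_poissonWeight_mul_sq hl).add ((hasSum_poissonWeight_mul_id hl).mul_left 2)).add
      (hasSum_poissonWeight hl)).of_eq
      (fun j => by push_cast; ring) rfl)).of_eq (fun j => by ring) (by ring)

theorem hasSum_poissonWeight_mul_pow_four {lam : ℝ} (hl : 0 < lam) :
    HasSum (fun j : ℕ => poissonWeight lam j * j ^ 4)
      (lam ^ 4 + 6 * lam ^ 3 + 7 * lam ^ 2 + lam) :=
  (HasSum.poissonWeight_mul_shift (f := fun j => (j : ℝ) ^ 3)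
    (((((hasSum_poissonWeight_mul_cube hl).add ((hasSum_poissonWeight_mul_sq hl).mul_left 3)).add
      ((hasSum_poissonWeight_mul_id hl).mul_left 3)).add (hasSum_poissonWeight hl)).of_eq
      (fun j => by push_cast; ring) rfl)).of_eq (fun j => by ring) (by ring)

theorem hasSum_poissonWeight_mul_sub_pow_three {lam : ℝ} (hl : 0 < lam) :
    HasSum (fun j : ℕ => poissonWeight lam j * ((j : ℝ) - lam) ^ 3) lam :=
  ((((hasSum_poissonWeight_mul_cube hl).sub
    ((hasSum_poissonWeight_mul_sq hl).mul_left (3 * lam))).add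
    ((hasSum_poissonWeight_mul_id hl).mul_left (3 * lam ^ 2))).sub
    ((hasSum_poissonWeight hl).mul_left (lam ^ 3))).of_eq (fun j => by ring) (by ring)

theorem hasSum_poissonWeight_mul_sub_pow_four {lam : ℝ} (hl : 0 < lam) :
    HasSum (fun j : ℕ => poissonWeight lam j * ((j : ℝ) - lam) ^ 4) (3 * lam ^ 2 + lam) :=
  (((((hasSum_poissonWeight_mul_pow_four hl).sub
    ((hasSum_poissonWeight_mul_cube hl).mul_left (4 * lam))).add
    ((hasSum_poissonWeight_mul_sq hl).mul_left (6 * lam ^ 2))).sub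
    ((hasSum_poissonWeight_mul_id hl).mul_left (4 * lam ^ 3))).add
    ((hasSum_poissonWeight hl).mul_left (lam ^ 4))).of_eq (fun j => by ring) (by ring)

theorem exists_hasSum_poissonWeight_div {lam : ℝ} (hl : 0 < lam) :
    ∃ s ≤ 1 / lam ^ 2,
      HasSum (fun j : ℕ => poissonWeight lam j * (1 / (((j : ℝ) + 1) * ((j : ℝ) + 2)))) s := by
  have h := ((hasSum_nat_add_iff' 2).2 (hasSum_poissonWeight hl)).mul_left (1 / lam ^ 2)
  refine ⟨_, ?_, h.of_eq (fun j => ?_) rfl⟩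
  · apply mul_le_of_le_one_right (by positivity)
    have := Finset.sum_nonneg fun i (_ : i ∈ Finset.range 2) => (poissonWeight_pos hl i).le
    linarith
  · have h1 := succ_mul_poissonWeight_succ lam j
    have h2 := succ_mul_poissonWeight_succ lam (j + 1)
    push_cast at h2
    have h3 : poissonWeight lam j = (j + 1) * poissonWeight lam (j + 1) / lam := by
      rw [h1]; field_simp
    have h4 : poissonWeight lam (j + 1) = (j + 1 + 1) * poissonWeight lam (j + 2) / lam := by
      rw [h2]; field_simp
    rw [h3, h4]
    field_simp
    ring

/-- An upper bound for the average over the `j`-th unit cell of the log-likelihood ratio between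
the smoothed Poisson law and the matching Gaussian. -/
noncomputable def cellBound (lam : ℝ) (j : ℕ) : ℝ :=
  lam * (-((j / lam - 1) ^ 3) / 12 + 4 * (j / lam - 1) ^ 4)
    + (1 / lam + 6 * lam * (1 / (((j : ℝ) + 1) * ((j : ℝ) + 2)))) / 2

theorem exists_hasSum_cellBound {lam : ℝ} (hl : 1 ≤ lam) :
    ∃ s ≤ 20 / lam, HasSum (fun j => poissonWeight lam j * cellBound lam j) s := by
  have h0 : 0 < lam := one_pos.trans_le hl
  obtain ⟨s, hs, h⟩ := exists_hasSum_poissonWeight_div h0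
  refine ⟨_, ?_, ((((hasSum_poissonWeight_mul_sub_pow_three h0).mul_left (-1 / (12 * lam ^ 2))).add
    ((hasSum_poissonWeight_mul_sub_pow_four h0).mul_left (4 / lam ^ 3))).add
    (((hasSum_poissonWeight h0).mul_left (1 / (2 * lam))).add (h.mul_left (3 * lam)))).of_eq
    (fun j => ?_) rfl⟩
  · have h1 : 3 * lam * s ≤ 3 * lam * (1 / lam ^ 2) := by gcongr
    have h2 : 1 / lam ^ 2 ≤ 1 / lam := by
      apply one_div_le_one_div_of_le h0; nlinarith
    have e1 : 3 * lam * (1 / lam ^ 2) = 3 * (1 / lam) := by field_simp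
    have e2 : -1 / (12 * lam ^ 2) * lam = - (1 / lam) / 12 := by field_simp
    have e3 : 4 / lam ^ 3 * (3 * lam ^ 2 + lam) = 12 * (1 / lam) + 4 * (1 / lam ^ 2) := by
      field_simp
      ring
    have e4 : 1 / (2 * lam) * 1 = (1 / lam) / 2 := by field_simp
    have e5 : 20 / lam = 20 * (1 / lam) := by ring
    have : 0 < 1 / lam := by positivity
    rw [e2, e3, e4, e5]
    linarith
  · unfold cellBound
    field_simp
    ring

theorem three_le_cellBound_zero {lam : ℝ} (hl : 1 ≤ lam) : 3 ≤ cellBound lam 0 := by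
  have h : 0 < lam⁻¹ := inv_pos.2 (one_pos.trans_le hl)
  unfold cellBound
  norm_num
  linarith

theorem cubic_quartic_bound {t : ℝ} (ht : 0 < t) :
    3 * t + 1 - t * Real.log t - 4 * Real.sqrt t ≤ -((t - 1) ^ 3) / 12 + 4 * (t - 1) ^ 4 := by
  linarith [cubic_le_mul_log ht, quartic_le_sqrt ht.le]

theorem sqrt_div_le_inv_add {lam : ℝ} (hl : 0 < lam) {j : ℕ} (hj : j ≠ 0) :
    Real.sqrt lam / (Real.sqrt j * j)
      ≤ 1 / lam + 6 * lam * (1 / (((j : ℝ) + 1) * ((j : ℝ) + 2))) := by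
  have hj1 : (1 : ℝ) ≤ j := by exact_mod_cast Nat.one_le_iff_ne_zero.2 hj
  have h1 : 1 / (j : ℝ) ^ 2 ≤ 6 * (1 / (((j : ℝ) + 1) * ((j : ℝ) + 2))) := by
    rw [mul_one_div, div_le_div_iff₀ (by positivity) (by positivity)]
    nlinarith
  refine le_trans ?_ (add_le_add_right (b := lam * (1 / (j : ℝ) ^ 2)) ?_ (1 / lam))
  · obtain ⟨a, ha, rfl⟩ : ∃ a : ℝ, 0 < a ∧ lam = a ^ 2 :=
      ⟨Real.sqrt lam, Real.sqrt_pos.2 hl, (Real.sq_sqrt hl.le).symm⟩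
    obtain ⟨b, hb, hjb⟩ : ∃ b : ℝ, 0 < b ∧ (j : ℝ) = b ^ 2 :=
      ⟨Real.sqrt j, Real.sqrt_pos.2 (by linarith), (Real.sq_sqrt (by linarith)).symm⟩
    rw [hjb, Real.sqrt_sq ha.le, Real.sqrt_sq hb.le]
    have e : 1 / a ^ 2 + a ^ 2 * (1 / (b ^ 2) ^ 2) - a / (b * b ^ 2)
        = (b ^ 4 + a ^ 4 - a ^ 3 * b) / (a ^ 2 * b ^ 4) := by field_simp
    rw [← sub_nonneg, e]
    have : 0 ≤ b ^ 4 + a ^ 4 - a ^ 3 * b := by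
      rcases le_total a b with h | h
      · have := pow_le_pow_left₀ ha.le h 3
        nlinarith [pow_pos ha 4, pow_pos hb 4]
      · nlinarith [mul_le_mul_of_nonneg_left h (pow_pos ha 3).le, pow_pos hb 4]
    positivity
  · calc lam * (1 / (j : ℝ) ^ 2) ≤ lam * (6 * (1 / (((j : ℝ) + 1) * ((j : ℝ) + 2)))) := by gcongr
      _ = _ := by ring

theorem log_ratio_le {lam : ℝ} (hl : 0 < lam) {j : ℕ} (hj : j ≠ 0) {x : ℝ}
    (hx : |x - j| ≤ 1 / 2) :
    Real.log (poissonWeight lam j) + Real.log x / 2 + Real.log (2 * Real.pi) / 2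
        + 2 * (Real.sqrt x - Real.sqrt lam) ^ 2
      ≤ cellBound lam j
        + (2 + 1 / (2 * j) - 2 * Real.sqrt lam / Real.sqrt j) * (x - j) := by
  have hj1 : (1 : ℝ) ≤ j := by exact_mod_cast Nat.one_le_iff_ne_zero.2 hj
  have hj0 : (0 : ℝ) < j := by linarith
  obtain ⟨hx1, hx2⟩ := abs_le.1 hx
  have hx0 : 0 < x := by linarith
  have hsl := Real.sq_sqrt hl.le
  have hsx := Real.sq_sqrt hx0.le
  have hsj := Real.sq_sqrt hj0.le
  have hsl0 := Real.sqrt_pos.2 hl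
  have hsj0 := Real.sqrt_pos.2 hj0
  have hweight : Real.log (poissonWeight lam j)
      = -lam + j * Real.log lam - Real.log (Nat.factorial j) := by
    unfold poissonWeight
    rw [Real.log_div (by positivity) (by positivity), Real.log_mul (by positivity) (by positivity),
      Real.log_exp, Real.log_pow]
  have hstir := Stirling.le_log_factorial_stirling hj
  have hlogx : Real.log x ≤ Real.log j + (x - j) / j := by
    have := Real.log_le_sub_one_of_pos (div_pos hx0 hj0)
    rw [Real.log_div hx0.ne' hj0.ne'] at this
    have e : (x - j) / j = x / j - 1 := by field_simp
    linarith
  have hsqrt : Real.sqrt lam * Real.sqrt j + Real.sqrt lam / Real.sqrt j * (x - j) / 2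
      - Real.sqrt lam / (Real.sqrt j * j) / 8 ≤ Real.sqrt lam * Real.sqrt x := by
    have h1 := quadratic_le_sqrt (s := (x - j) / j) (by rw [le_div_iff₀ hj0]; linarith)
    have e : x = j * (1 + (x - j) / j) := by field_simp; ring
    have h2 : Real.sqrt x = Real.sqrt j * Real.sqrt (1 + (x - j) / j) := by
      rw [← Real.sqrt_mul hj0.le, ← e]
    have h3 : (x - j) ^ 2 ≤ 1 / 4 := by nlinarith
    have h4 : 1 + (x - j) / j / 2 - 1 / j ^ 2 / 8 ≤ Real.sqrt (1 + (x - j) / j) := by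
      refine le_trans ?_ h1
      have : ((x - j) / j) ^ 2 ≤ 1 / j ^ 2 / 4 := by
        rw [div_pow, div_div, div_le_div_iff₀ (by positivity) (by positivity)]
        nlinarith [sq_nonneg (j : ℝ)]
      linarith
    rw [h2]
    calc _ = Real.sqrt lam * (Real.sqrt j * (1 + (x - j) / j / 2 - 1 / j ^ 2 / 8)) := by
          generalize Real.sqrt j = b at *
          rw [← hsj]
          field_simp
      _ ≤ _ := by gcongr
  have hmain := mul_le_mul_of_nonneg_left (cubic_quartic_bound (div_pos hj0 hl)) hl.le
  have e1 : lam * (3 * (j / lam) + 1 - j / lam * Real.log (j / lam) - 4 * Real.sqrt (j / lam))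
      = 3 * j + lam - j * (Real.log j - Real.log lam) - 4 * (Real.sqrt lam * Real.sqrt j) := by
    rw [Real.log_div hj0.ne' hl.ne', Real.sqrt_div hj0.le]
    generalize Real.sqrt lam = a at *
    rw [← hsl]
    field_simp
  have hrem := sqrt_div_le_inv_add hl hj
  have e2 : (2 + 1 / (2 * j) - 2 * Real.sqrt lam / Real.sqrt j) * (x - j)
      = 2 * (x - j) + (x - j) / j / 2 - 4 * (Real.sqrt lam / Real.sqrt j * (x - j) / 2) := by
    field_simp
    ring
  have e3 : 2 * (Real.sqrt x - Real.sqrt lam) ^ 2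
      = 2 * x + 2 * lam - 4 * (Real.sqrt lam * Real.sqrt x) := by
    rw [← hsx, ← hsl]
    simp only [Real.sqrt_sq (Real.sqrt_nonneg _)]
    ring
  unfold cellBound
  rw [hweight, e2, e3]
  linarith

/-- The inverse `z ↦ z|z|/4` of `sqrtTransform`. -/
noncomputable def signedSq (z : ℝ) : ℝ := z * |z| / 4

theorem sqrtTransform_of_pos {x : ℝ} (hx : 0 < x) : sqrtTransform x = 2 * Real.sqrt x := by
  simp [sqrtTransform, Real.sign_of_pos hx, abs_of_pos hx]

theorem sqrtTransform_neg (x : ℝ) : sqrtTransform (-x) = -sqrtTransform x := by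
  simp [sqrtTransform, Real.sign_neg]

theorem sqrtTransform_zero : sqrtTransform 0 = 0 := by simp [sqrtTransform]

theorem signedSq_neg (x : ℝ) : signedSq (-x) = -signedSq x := by
  simp only [signedSq, abs_neg]; ring

theorem signedSq_sqrtTransform (x : ℝ) : signedSq (sqrtTransform x) = x := by
  have key : ∀ {y : ℝ}, 0 < y → signedSq (sqrtTransform y) = y := by
    intro y hy
    rw [sqrtTransform_of_pos hy, signedSq, abs_of_nonneg (by positivity)]
    linarith [Real.mul_self_sqrt hy.le]
  rcases lt_trichotomy x 0 with h | rfl | h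
  · have := key (neg_pos.2 h)
    rw [sqrtTransform_neg, signedSq_neg] at this
    linarith
  · simp [sqrtTransform_zero, signedSq]
  · exact key h

theorem sqrtTransform_signedSq (z : ℝ) : sqrtTransform (signedSq z) = z := by
  have key : ∀ {y : ℝ}, 0 < y → sqrtTransform (signedSq y) = y := by
    intro y hy
    have h : signedSq y = (y / 2) ^ 2 := by rw [signedSq, abs_of_pos hy]; ring
    rw [sqrtTransform_of_pos (by rw [h]; positivity), h, Real.sqrt_sq (by positivity)]
    ring
  rcases lt_trichotomy z 0 with h | rfl | h
  · have := key (neg_pos.2 h)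
    rw [signedSq_neg, sqrtTransform_neg] at this
    linarith
  · simp [sqrtTransform_zero, signedSq]
  · exact key h

theorem measurable_sqrtTransform : Measurable sqrtTransform := by
  have hs : Measurable Real.sign :=
    Measurable.ite measurableSet_Iio measurable_const
      (Measurable.ite measurableSet_Ioi measurable_const measurable_const)
  unfold sqrtTransform
  fun_prop

theorem measurable_signedSq : Measurable signedSq := by
  unfold signedSq
  fun_prop

theorem hasDerivAt_signedSq (z : ℝ) : HasDerivAt signedSq (|z| / 2) z := by
  rcases eq_or_ne z 0 with rfl | hz
  · rw [hasDerivAt_iff_tendsto_slope_zero]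
    have h : Filter.Tendsto (fun t : ℝ => |t| / 4) (nhdsWithin 0 {0}ᶜ) (nhds (|0| / 2)) := by
      have : Continuous fun t : ℝ => |t| / 4 := by fun_prop
      simpa using (this.tendsto 0).mono_left nhdsWithin_le_nhds
    refine h.congr' ?_
    filter_upwards [self_mem_nhdsWithin] with t ht
    have ht' : t ≠ 0 := ht
    simp only [signedSq, zero_add, smul_eq_mul, zero_mul, zero_div, sub_zero]
    field_simp
  · refine (((hasDerivAt_id z).mul (hasDerivAt_abs hz)).div_const 4).congr_deriv ?_
    rcases lt_or_gt_of_ne hz with h | h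
    · simp [sign_neg h, abs_of_neg h]; ring
    · simp [sign_pos h, abs_of_pos h]; ring

theorem map_sqrtTransform_withDensity (q : ℝ → ENNReal) :
    (volume.withDensity q).map sqrtTransform
      = volume.withDensity fun z => ENNReal.ofReal (|z| / 2) * q (signedSq z) := by
  ext A hA
  have hpre : sqrtTransform ⁻¹' A = signedSq '' A := by
    ext x
    constructor
    · exact fun hx => ⟨_, hx, signedSq_sqrtTransform x⟩
    · rintro ⟨z, hz, rfl⟩
      simpa [sqrtTransform_signedSq] using hz
  rw [Measure.map_apply measurable_sqrtTransform hA,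
    withDensity_apply _ (measurable_sqrtTransform hA), withDensity_apply _ hA, hpre,
    lintegral_image_eq_lintegral_abs_deriv_mul hA
      (fun z _ => (hasDerivAt_signedSq z).hasDerivWithinAt)
      (Function.LeftInverse.injective sqrtTransform_signedSq).injOn]
  simp only [abs_div, abs_abs, abs_two]

/-- The density of `poissonUnifLaw`. -/
noncomputable def poissonUnifDensity (lam : ℝ) : ℝ → ENNReal :=
  ∑' j : ℕ, (Set.Ico ((j : ℝ) - 1 / 2) ((j : ℝ) + 1 / 2)).indicator
    fun _ => ENNReal.ofReal (poissonWeight lam j)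

theorem measurable_poissonUnifDensity (lam : ℝ) : Measurable (poissonUnifDensity lam) :=
  Measurable.tsum' fun _ => measurable_const.indicator measurableSet_Ico

theorem poissonUnifDensity_eq (lam : ℝ) {j : ℕ} {x : ℝ}
    (hx : x ∈ Set.Ico ((j : ℝ) - 1 / 2) ((j : ℝ) + 1 / 2)) :
    poissonUnifDensity lam x = ENNReal.ofReal (poissonWeight lam j) := by
  rw [poissonUnifDensity, ENNReal.tsum_apply, tsum_eq_single j, Set.indicator_of_mem hx]
  intro k hk
  refine Set.indicator_of_notMem (fun hxk => hk ?_) _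
  have h1 : (k : ℝ) < j + 1 := by linarith [hx.2, hxk.1]
  have h2 : (j : ℝ) < k + 1 := by linarith [hxk.2, hx.1]
  norm_cast at h1 h2
  omega

theorem poissonUnifLaw_eq_withDensity (lam : ℝ) :
    poissonUnifLaw lam = volume.withDensity (poissonUnifDensity lam) := by
  rw [poissonUnifDensity,
    withDensity_tsum fun _ => measurable_const.indicator measurableSet_Ico]
  simp only [withDensity_indicator measurableSet_Ico, withDensity_const]
  rfl

theorem isProbabilityMeasure_poissonUnifLaw {lam : ℝ} (hl : 0 < lam) :
    IsProbabilityMeasure (poissonUnifLaw lam) := by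
  refine ⟨?_⟩
  rw [poissonUnifLaw, Measure.sum_apply _ MeasurableSet.univ]
  have h : ∀ j : ℕ, (ENNReal.ofReal (Real.exp (-lam) * lam ^ j / (Nat.factorial j)) •
      (volume.restrict (Set.Ico ((j : ℝ) - 1 / 2) ((j : ℝ) + 1 / 2)))) Set.univ
      = ENNReal.ofReal (poissonWeight lam j) := by
    intro j
    rw [Measure.smul_apply, Measure.restrict_apply_univ, Real.volume_Ico,
      show (j : ℝ) + 1 / 2 - (j - 1 / 2) = 1 by ring]
    simp [poissonWeight]
  simp only [h]
  rw [← ENNReal.ofReal_tsum_of_nonneg (fun j => (poissonWeight_pos hl j).le)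
    (hasSum_poissonWeight hl).summable, (hasSum_poissonWeight hl).tsum_eq, ENNReal.ofReal_one]

theorem map_poissonUnifLaw_eq_withDensity (lam : ℝ) :
    (poissonUnifLaw lam).map sqrtTransform = volume.withDensity fun z =>
      ENNReal.ofReal (|z| / 2) * poissonUnifDensity lam (signedSq z) := by
  rw [poissonUnifLaw_eq_withDensity, map_sqrtTransform_withDensity]

theorem map_poissonUnifLaw_absolutelyContinuous (lam : ℝ) :
    (poissonUnifLaw lam).map sqrtTransform ≪ volume := by
  rw [map_poissonUnifLaw_eq_withDensity]
  exact withDensity_absolutelyContinuous _ _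

theorem poissonGtilde_sqrtTransform_ae (lam : ℝ) :
    ∀ᵐ x ∂poissonUnifLaw lam, poissonGtilde lam (sqrtTransform x)
      = |sqrtTransform x| / 2 * (poissonUnifDensity lam x).toReal := by
  have hm : Measurable fun z : ℝ =>
      ENNReal.ofReal (|z| / 2) * poissonUnifDensity lam (signedSq z) :=
    (by fun_prop : Measurable fun z : ℝ => ENNReal.ofReal (|z| / 2)).mul
      ((measurable_poissonUnifDensity lam).comp measurable_signedSq)
  have h := Measure.rnDeriv_withDensity volume hm
  rw [← map_poissonUnifLaw_eq_withDensity] at h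
  have h' := ae_of_ae_map measurable_sqrtTransform.aemeasurable
    ((map_poissonUnifLaw_absolutelyContinuous lam).ae_le h)
  filter_upwards [h'] with x hx
  rw [poissonGtilde, hx, signedSq_sqrtTransform, ENNReal.toReal_mul,
    ENNReal.toReal_ofReal (by positivity)]

theorem poissonGtilde_nonneg (lam z : ℝ) : 0 ≤ poissonGtilde lam z := ENNReal.toReal_nonneg

theorem integrable_poissonGtilde {lam : ℝ} (hl : 0 < lam) : Integrable (poissonGtilde lam) := by
  have := isProbabilityMeasure_poissonUnifLaw hl
  have := Measure.isProbabilityMeasure_map (μ := poissonUnifLaw lam)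
    measurable_sqrtTransform.aemeasurable
  exact Measure.integrable_toReal_rnDeriv

theorem integral_poissonGtilde {lam : ℝ} (hl : 0 < lam) : ∫ z, poissonGtilde lam z = 1 := by
  have := isProbabilityMeasure_poissonUnifLaw hl
  have := Measure.isProbabilityMeasure_map (μ := poissonUnifLaw lam)
    measurable_sqrtTransform.aemeasurable
  simpa [poissonGtilde] using
    Measure.integral_toReal_rnDeriv (map_poissonUnifLaw_absolutelyContinuous lam)

theorem gaussPdf_pos (μ z : ℝ) : 0 < gaussPdf μ z := by unfold gaussPdf; positivity

theorem gaussPdf_eq (μ : ℝ) : gaussPdf μ = ProbabilityTheory.gaussianPDFReal μ 1 := by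
  ext z
  simp [gaussPdf, ProbabilityTheory.gaussianPDFReal]

theorem integrable_gaussPdf (μ : ℝ) : Integrable (gaussPdf μ) := by
  rw [gaussPdf_eq]; exact ProbabilityTheory.integrable_gaussianPDFReal μ 1

theorem integral_gaussPdf (μ : ℝ) : ∫ z, gaussPdf μ z = 1 := by
  rw [gaussPdf_eq]; exact ProbabilityTheory.integral_gaussianPDFReal_eq_one μ one_ne_zero

section Hellinger

variable {f g h : ℝ → ℝ}

theorem integrable_sqrt_mul_sqrt (hf : Integrable f) (hg : Integrable g) (hf0 : ∀ z, 0 ≤ f z)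
    (hg0 : ∀ z, 0 ≤ g z) : Integrable fun z => Real.sqrt (f z) * Real.sqrt (g z) := by
  refine (hf.add hg).mono' ((Real.continuous_sqrt.comp_aestronglyMeasurable hf.1).mul
    (Real.continuous_sqrt.comp_aestronglyMeasurable hg.1)) (.of_forall fun z => ?_)
  rw [Real.norm_of_nonneg (by positivity), Pi.add_apply]
  nlinarith [Real.sq_sqrt (hf0 z), Real.sq_sqrt (hg0 z), Real.sqrt_nonneg (f z),
    Real.sqrt_nonneg (g z), sq_nonneg (Real.sqrt (f z) - Real.sqrt (g z))]

theorem sq_sqrt_sub_sqrt {a b : ℝ} (ha : 0 ≤ a) (hb : 0 ≤ b) :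
    (Real.sqrt a - Real.sqrt b) ^ 2 = a + b - 2 * (Real.sqrt a * Real.sqrt b) := by
  rw [sub_sq, Real.sq_sqrt ha, Real.sq_sqrt hb]; ring

theorem integrable_sq_sqrt_sub_sqrt (hf : Integrable f) (hg : Integrable g)
    (hf0 : ∀ z, 0 ≤ f z) (hg0 : ∀ z, 0 ≤ g z) :
    Integrable fun z => (Real.sqrt (f z) - Real.sqrt (g z)) ^ 2 := by
  simp only [sq_sqrt_sub_sqrt (hf0 _) (hg0 _)]
  exact (hf.add hg).sub ((integrable_sqrt_mul_sqrt hf hg hf0 hg0).const_mul 2)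

theorem Hsq_eq_two_sub (hf : Integrable f) (hg : Integrable g) (hf0 : ∀ z, 0 ≤ f z)
    (hg0 : ∀ z, 0 ≤ g z) (hf1 : ∫ z, f z = 1) (hg1 : ∫ z, g z = 1) :
    Hsq f g = 2 - 2 * ∫ z, Real.sqrt (f z) * Real.sqrt (g z) := by
  have hi := (integrable_sqrt_mul_sqrt hf hg hf0 hg0).const_mul 2
  simp only [Hsq, sq_sqrt_sub_sqrt (hf0 _) (hg0 _)]
  rw [integral_sub (f := fun z => f z + g z) (hf.add hg) hi, integral_add hf hg, hf1, hg1, integral_const_mul]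
  norm_num

theorem Hsq_le_two_mul_add (hf : Integrable f) (hg : Integrable g) (hh : Integrable h)
    (hf0 : ∀ z, 0 ≤ f z) (hg0 : ∀ z, 0 ≤ g z) (hh0 : ∀ z, 0 ≤ h z) :
    Hsq f h ≤ 2 * Hsq f g + 2 * Hsq g h := by
  have h1 := (integrable_sq_sqrt_sub_sqrt hf hg hf0 hg0).const_mul 2
  have h2 := (integrable_sq_sqrt_sub_sqrt hg hh hg0 hh0).const_mul 2
  simp only [Hsq]
  rw [← integral_const_mul, ← integral_const_mul, ← integral_add h1 h2]
  refine integral_mono (integrable_sq_sqrt_sub_sqrt hf hh hf0 hh0) (h1.add h2) fun z => ?_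
  nlinarith [sq_nonneg (Real.sqrt (f z) - 2 * Real.sqrt (g z) + Real.sqrt (h z))]

end Hellinger

theorem Hsq_gaussPdf_le (a b : ℝ) : Hsq (gaussPdf a) (gaussPdf b) ≤ (a - b) ^ 2 / 4 := by
  rw [Hsq_eq_two_sub (integrable_gaussPdf a) (integrable_gaussPdf b)
    (fun z => (gaussPdf_pos a z).le) (fun z => (gaussPdf_pos b z).le) (integral_gaussPdf a)
    (integral_gaussPdf b)]
  have h : ∀ z, Real.sqrt (gaussPdf a z) * Real.sqrt (gaussPdf b z)
      = Real.exp (-(a - b) ^ 2 / 8) * gaussPdf ((a + b) / 2) z := by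
    intro z
    rw [← Real.sqrt_mul (gaussPdf_pos a z).le, Real.sqrt_eq_iff_mul_self_eq
      (mul_pos (gaussPdf_pos a z) (gaussPdf_pos b z)).le
      (mul_pos (Real.exp_pos _) (gaussPdf_pos _ z)).le]
    simp only [gaussPdf]
    generalize (Real.sqrt (2 * Real.pi))⁻¹ = c
    have e : Real.exp (-(a - b) ^ 2 / 8) * Real.exp (-(z - (a + b) / 2) ^ 2 / 2)
        * (Real.exp (-(a - b) ^ 2 / 8) * Real.exp (-(z - (a + b) / 2) ^ 2 / 2))
        = Real.exp (-(z - a) ^ 2 / 2) * Real.exp (-(z - b) ^ 2 / 2) := by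
      simp only [← Real.exp_add]
      congr 1
      ring
    linear_combination (-c ^ 2) * e
  simp only [h]
  rw [integral_const_mul, integral_gaussPdf]
  linarith [Real.add_one_le_exp (-(a - b) ^ 2 / 8)]

theorem one_sub_cellBound_le_sqrt_div_sqrt {lam : ℝ} (hl : 1 ≤ lam) {j : ℕ} {x : ℝ}
    (hx : x ∈ Set.Ico ((j : ℝ) - 1 / 2) ((j : ℝ) + 1 / 2)) :
    1 - (cellBound lam j
        + (2 + 1 / (2 * j) - 2 * Real.sqrt lam / Real.sqrt j) * (x - j)) / 2
      ≤ Real.sqrt (gaussPdf (2 * Real.sqrt lam) (sqrtTransform x))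
        / Real.sqrt (|sqrtTransform x| / 2 * poissonWeight lam j) := by
  rcases eq_or_ne j 0 with rfl | hj
  · refine le_trans ?_ (by positivity)
    have := three_le_cellBound_zero hl
    have := hx.1
    norm_num at this ⊢
    linarith
  · have hj1 : (1 : ℝ) ≤ j := by exact_mod_cast Nat.one_le_iff_ne_zero.2 hj
    have hl0 : 0 < lam := one_pos.trans_le hl
    have hx0 : 0 < x := by linarith [hx.1]
    have hp := poissonWeight_pos hl0 j
    have hsx := Real.sqrt_pos.2 hx0
    have hL := log_ratio_le hl0 hj (x := x)
      (abs_le.2 ⟨by linarith [hx.1], by linarith [hx.2]⟩)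
    rw [sqrtTransform_of_pos hx0, abs_of_pos (by positivity), mul_div_cancel_left₀ _ two_ne_zero,
      ← Real.sqrt_div (gaussPdf_pos _ _).le]
    set R := gaussPdf (2 * Real.sqrt lam) (2 * Real.sqrt x) / (Real.sqrt x * poissonWeight lam j)
      with hR
    have hR0 : 0 < R := div_pos (gaussPdf_pos _ _) (by positivity)
    have hlogR : Real.log R = -(Real.log (poissonWeight lam j) + Real.log x / 2
        + Real.log (2 * Real.pi) / 2 + 2 * (Real.sqrt x - Real.sqrt lam) ^ 2) := by
      rw [hR, Real.log_div (gaussPdf_pos _ _).ne' (by positivity),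
        Real.log_mul hsx.ne' hp.ne', gaussPdf, Real.log_mul (by positivity) (by positivity),
        Real.log_exp, Real.log_inv, Real.log_sqrt (by positivity), Real.log_sqrt hx0.le]
      ring
    have hlog := Real.log_le_sub_one_of_pos (Real.sqrt_pos.2 hR0)
    rw [Real.log_sqrt hR0.le] at hlog
    linarith

theorem setIntegral_cell (c a : ℝ) (j : ℕ) :
    ∫ x in Set.Ico ((j : ℝ) - 1 / 2) ((j : ℝ) + 1 / 2), (1 - (c + a * (x - j)) / 2)
      = 1 - c / 2 := by
  rw [integral_Ico_eq_integral_Ioc, ← intervalIntegral.integral_of_le (by linarith)]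
  have h : ∀ x ∈ Set.uIcc ((j : ℝ) - 1 / 2) ((j : ℝ) + 1 / 2),
      HasDerivAt (fun x => x - (c * x + a * (x - j) ^ 2 / 2) / 2) (1 - (c + a * (x - j)) / 2) x := by
    intro x _
    refine ((hasDerivAt_id x).sub ((((hasDerivAt_id x).const_mul c).add
      (((((hasDerivAt_id x).sub_const (j : ℝ)).pow 2).const_mul a).div_const 2)).div_const
        2)).congr_deriv ?_
    simp only [id_eq]
    ring
  rw [intervalIntegral.integral_eq_sub_of_hasDerivAt h
    ((by fun_prop : Continuous fun x : ℝ => 1 - (c + a * (x - j)) / 2).intervalIntegrable _ _)]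
  ring

theorem Hsq_poissonGtilde_gaussPdf_le {lam : ℝ} (hl : 1 ≤ lam) :
    Hsq (poissonGtilde lam) (gaussPdf (2 * Real.sqrt lam)) ≤ 20 / lam := by
  have hl0 : 0 < lam := one_pos.trans_le hl
  set m := 2 * Real.sqrt lam with hm
  have := isProbabilityMeasure_poissonUnifLaw hl0
  have := Measure.isProbabilityMeasure_map (μ := poissonUnifLaw lam)
    measurable_sqrtTransform.aemeasurable
  have hac := map_poissonUnifLaw_absolutelyContinuous lam
  have hg0 : ∀ z, 0 ≤ gaussPdf m z := fun z => (gaussPdf_pos m z).le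
  rw [Hsq_eq_two_sub (integrable_poissonGtilde hl0) (integrable_gaussPdf m)
    (poissonGtilde_nonneg lam) hg0 (integral_poissonGtilde hl0) (integral_gaussPdf m)]
  have hprod := integrable_sqrt_mul_sqrt (integrable_poissonGtilde hl0) (integrable_gaussPdf m)
    (poissonGtilde_nonneg lam) hg0
  set r : ℝ → ℝ := fun z => Real.sqrt (gaussPdf m z) / Real.sqrt (poissonGtilde lam z) with hr
  have heq : (fun z => Real.sqrt (poissonGtilde lam z) * Real.sqrt (gaussPdf m z))
      = fun z => (((poissonUnifLaw lam).map sqrtTransform).rnDeriv volume z).toReal • r z := by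
    ext z
    change _ = poissonGtilde lam z * _
    rw [hr, mul_div_left_comm, Real.div_sqrt, mul_comm]
  rw [heq] at hprod
  rw [heq, integral_rnDeriv_smul hac]
  have hrint := (integrable_rnDeriv_smul_iff hac).1 hprod
  rw [integral_map measurable_sqrtTransform.aemeasurable hrint.1]
  have hrT := hrint.comp_measurable measurable_sqrtTransform
  have hsum := hasSum_integral_measure hrT
  obtain ⟨s, hs, hcell⟩ := exists_hasSum_cellBound hl
  have hle := hasSum_le (fun j => ?_)
    ((hasSum_poissonWeight hl0).sub (hcell.div_const 2)) hsum
  · simp only [Function.comp_def] at hle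
    change 1 - s / 2 ≤ ∫ x, r (sqrtTransform x) ∂poissonUnifLaw lam at hle
    linarith
  · have hp := poissonWeight_pos hl0 j
    set μj : Measure ℝ := ENNReal.ofReal (Real.exp (-lam) * lam ^ j / (Nat.factorial j)) •
      (volume.restrict (Set.Ico ((j : ℝ) - 1 / 2) ((j : ℝ) + 1 / 2))) with hμj
    have hμle : μj ≤ poissonUnifLaw lam := Measure.le_sum _ j
    set a : ℝ := 2 + 1 / (2 * j) - 2 * Real.sqrt lam / Real.sqrt j with ha
    have hval : ∫ x, (1 - (cellBound lam j + a * (x - j)) / 2) ∂μj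
        = poissonWeight lam j - poissonWeight lam j * cellBound lam j / 2 := by
      rw [hμj, integral_smul_measure, setIntegral_cell]
      change (ENNReal.ofReal (poissonWeight lam j)).toReal * _ = _
      rw [ENNReal.toReal_ofReal hp.le]
      ring
    rw [← hval]
    refine integral_mono_ae ?_ (hrT.mono_measure hμle) ?_
    · refine Integrable.smul_measure ?_ ENNReal.ofReal_ne_top
      exact ((by fun_prop : Continuous fun x : ℝ =>
        1 - (cellBound lam j + a * (x - j)) / 2).integrableOn_Icc).mono_set Set.Ico_subset_Icc_self
    · have hmem : ∀ᵐ x ∂μj, x ∈ Set.Ico ((j : ℝ) - 1 / 2) ((j : ℝ) + 1 / 2) :=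
        Measure.ae_smul_measure (ae_restrict_mem measurableSet_Ico) _
      filter_upwards [hmem, (Measure.absolutelyContinuous_of_le hμle).ae_le
        (poissonGtilde_sqrtTransform_ae lam)] with x hx hgx
      simp only [Function.comp_apply, hr]
      rw [hgx, poissonUnifDensity_eq lam hx, ENNReal.toReal_ofReal hp.le]
      exact one_sub_cellBound_le_sqrt_div_sqrt hl hx

/-- There is a universal constant `C` such that for all `λ > 0` and all `μ`,
`H²(g̃_λ, φ_μ) ≤ C/λ + (2√λ − μ)²/2`. -/
theorem poisson_hellinger_bound :
    ∃ C : ℝ, ∀ lam : ℝ, 0 < lam → ∀ μ : ℝ,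
      Hsq (poissonGtilde lam) (gaussPdf μ) ≤ C / lam + (2 * Real.sqrt lam - μ) ^ 2 / 2 := by
  refine ⟨40, fun lam hl μ => ?_⟩
  have hg := integrable_poissonGtilde hl
  have hφ0 : ∀ ν z, 0 ≤ gaussPdf ν z := fun ν z => (gaussPdf_pos ν z).le
  rcases le_total 1 lam with h1 | h1
  · have htri := Hsq_le_two_mul_add hg (integrable_gaussPdf (2 * Real.sqrt lam))
      (integrable_gaussPdf μ) (poissonGtilde_nonneg lam) (hφ0 _) (hφ0 μ)
    have hP := Hsq_poissonGtilde_gaussPdf_le h1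
    have hG := Hsq_gaussPdf_le (2 * Real.sqrt lam) μ
    have e : 40 / lam = 2 * (20 / lam) := by ring
    rw [e]
    linarith
  · rw [Hsq_eq_two_sub hg (integrable_gaussPdf μ) (poissonGtilde_nonneg lam) (hφ0 μ)
      (integral_poissonGtilde hl) (integral_gaussPdf μ)]
    have hB : 0 ≤ ∫ z, Real.sqrt (poissonGtilde lam z) * Real.sqrt (gaussPdf μ z) :=
      integral_nonneg fun z => by positivity
    have hC : 2 ≤ 40 / lam := by
      rw [le_div_iff₀ hl]
      linarith
    have := sq_nonneg (2 * Real.sqrt lam - μ)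
    linarith
end

section
/- There exists a universal constant C' < ∞ such that for every λ > 0, if X_λ is a Poisson random variable with mean λ, then 1 − E√(X_λ/λ) ≤ min(1, C'/λ); equivalently, 1 − Σ_{j=0}^∞ e^{−λ}(λ^j/j!)·√(j/λ) ≤ min(1, C'/λ). -/
theorem hasSum_poisson_weights (lam : ℝ) :
    HasSum (fun j : ℕ => Real.exp (-lam) * lam ^ j / (Nat.factorial j)) 1 := by
  have h := (NormedSpace.expSeries_div_hasSum_exp lam).mul_left (Real.exp (-lam))
  rw [← Real.exp_eq_exp_ℝ, ← Real.exp_add, neg_add_cancel, Real.exp_zero] at h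
  simpa only [mul_div_assoc] using h

/-- The Stein identity `E[X g(X)] = λ E[g(X + 1)]` for a Poisson variable `X` of mean `λ`. -/
theorem hasSum_poisson_stein {lam a : ℝ} {g : ℕ → ℝ}
    (h : HasSum (fun j : ℕ => Real.exp (-lam) * lam ^ j / (Nat.factorial j) * g (j + 1)) a) :
    HasSum (fun j : ℕ => Real.exp (-lam) * lam ^ j / (Nat.factorial j) * (j * g j))
      (lam * a) := by
  rw [← hasSum_nat_add_iff' 1]
  simp only [Finset.range_one, Finset.sum_singleton, Nat.cast_zero, zero_mul, mul_zero, sub_zero]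
  refine (congrArg (HasSum · (lam * a)) (funext fun j => ?_)).mpr (h.mul_left lam)
  have hj : (j : ℝ) + 1 ≠ 0 := by positivity
  have hf : (Nat.factorial j : ℝ) ≠ 0 := by positivity
  rw [Nat.factorial_succ]
  push_cast
  field_simp
  ring

theorem hasSum_poisson_mean (lam : ℝ) :
    HasSum (fun j : ℕ => Real.exp (-lam) * lam ^ j / (Nat.factorial j) * j) lam := by
  simpa using hasSum_poisson_stein (a := 1) (g := fun _ => 1)
    (by simpa using hasSum_poisson_weights lam)

theorem hasSum_poisson_sq (lam : ℝ) :
    HasSum (fun j : ℕ => Real.exp (-lam) * lam ^ j / (Nat.factorial j) * (j * j))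
      (lam * (lam + 1)) := by
  refine hasSum_poisson_stein (g := fun j => (j : ℝ)) ?_
  simpa [mul_add] using (hasSum_poisson_mean lam).add (hasSum_poisson_weights lam)

theorem half_three_mul_sub_sq_le_sqrt {x : ℝ} (hx : 0 ≤ x) :
    (3 * x - x * x) / 2 ≤ Real.sqrt x := by
  obtain ⟨s, hs, rfl⟩ : ∃ s, 0 ≤ s ∧ x = s ^ 2 :=
    ⟨Real.sqrt x, Real.sqrt_nonneg x, (Real.sq_sqrt hx).symm⟩
  rw [Real.sqrt_sq hs]
  have : 0 ≤ (s - 1) ^ 2 * (s * (s + 2)) := by positivity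
  linarith

theorem sqrt_le_half_one_add {x : ℝ} (hx : 0 ≤ x) : Real.sqrt x ≤ (1 + x) / 2 := by
  nlinarith [Real.sq_sqrt hx, sq_nonneg (Real.sqrt x - 1)]

theorem summable_poisson_sqrt {lam : ℝ} (hlam : 0 < lam) :
    Summable (fun j : ℕ =>
      Real.exp (-lam) * lam ^ j / (Nat.factorial j) * Real.sqrt (j / lam)) := by
  refine Summable.of_nonneg_of_le (fun j => by positivity)
    (fun j => mul_le_mul_of_nonneg_left (sqrt_le_half_one_add (by positivity)) (by positivity)) ?_
  have h := ((hasSum_poisson_weights lam).add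
    ((hasSum_poisson_mean lam).div_const lam)).div_const 2
  refine h.summable.congr fun j => ?_
  ring

/-- For `X_λ ~ Poisson(λ)`, there is a universal constant `C'` with
`1 − E√(X_λ/λ) ≤ min(1, C'/λ)` for every `λ > 0`. -/
theorem poisson_sqrt_mean_bound :
    ∃ C' : ℝ, ∀ lam : ℝ, 0 < lam →
      1 - ∑' j : ℕ, Real.exp (-lam) * lam ^ j / (Nat.factorial j) * Real.sqrt (j / lam)
        ≤ min 1 (C' / lam) := by
  refine ⟨1 / 2, fun lam hlam => le_min ?_ ?_⟩
  · rw [sub_le_self_iff]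
    exact tsum_nonneg fun j => by positivity
  · have h := (((hasSum_poisson_mean lam).mul_left (3 / lam)).sub
      ((hasSum_poisson_sq lam).div_const (lam ^ 2))).div_const 2
    have hle := hasSum_le (fun j => ?_) h (summable_poisson_sqrt hlam).hasSum
    · have : (3 / lam * lam - lam * (lam + 1) / lam ^ 2) / 2 = 1 - 1 / 2 / lam := by
        field_simp
        ring
      linarith
    · refine le_of_eq_of_le ?_ (mul_le_mul_of_nonneg_left
        (half_three_mul_sub_sq_le_sqrt (x := j / lam) (by positivity)) (by positivity))
      field_simp
end

section
/- For every real θ, θ²/4 − θ⁴/32 ≤ log((2 + e^θ + e^{−θ})/4) ≤ θ²/4 + θ⁴/24. Equivalently, if p ∈ (0, 1), q = 1 − p and θ = log(p/q), then −θ²/4 − θ⁴/24 ≤ log(4pq) ≤ −θ²/4 + θ⁴/32. -/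
/-- The quadratic lower bound for the hyperbolic cosine. -/
theorem one_add_sq_div_two_le_cosh (x : ℝ) : 1 + x ^ 2 / 2 ≤ Real.cosh x := by
  have hcosh : Real.cosh x = 1 + 2 * Real.sinh (x / 2) ^ 2 := by
    have h := Real.cosh_two_mul (x / 2)
    rw [mul_div_cancel₀ x two_ne_zero, Real.cosh_sq] at h
    linarith
  have hsinh : (x / 2) ^ 2 ≤ Real.sinh (x / 2) ^ 2 := by
    rw [sq_le_sq]
    rcases le_total 0 (x / 2) with h | h
    · have := Real.self_le_sinh_iff.2 h
      rwa [abs_of_nonneg h, abs_of_nonneg (h.trans this)]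
    · have := Real.sinh_le_self_iff.2 h
      rw [abs_of_nonpos h, abs_of_nonpos (this.trans h)]
      linarith
  linarith

theorem sub_sq_le_log_one_add {u : ℝ} (hu : 0 ≤ u) : u - u ^ 2 ≤ Real.log (1 + u) := by
  have hpos : 0 < 1 + u := by linarith
  refine le_trans ?_ (Real.one_sub_inv_le_log_of_pos hpos)
  have h : 1 - (1 + u)⁻¹ - (u - u ^ 2) = u ^ 3 / (1 + u) := by
    field_simp
    ring
  have : 0 ≤ u ^ 3 / (1 + u) := by positivity
  linarith

theorem log_cosh_le_sq_div_two (x : ℝ) : Real.log (Real.cosh x) ≤ x ^ 2 / 2 :=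
  (Real.log_le_iff_le_exp (Real.cosh_pos x)).2 (Real.cosh_le_exp_half_sq x)

theorem sq_div_two_sub_le_log_cosh (x : ℝ) :
    x ^ 2 / 2 - x ^ 4 / 4 ≤ Real.log (Real.cosh x) := by
  have h := sub_sq_le_log_one_add (u := x ^ 2 / 2) (by positivity)
  have hlog := Real.log_le_log (by positivity) (one_add_sq_div_two_le_cosh x)
  linarith

theorem two_add_exp_add_exp_neg_div_four (θ : ℝ) :
    (2 + Real.exp θ + Real.exp (-θ)) / 4 = Real.cosh (θ / 2) ^ 2 := by
  have h := Real.cosh_two_mul (θ / 2)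
  rw [mul_div_cancel₀ θ two_ne_zero, Real.sinh_sq, Real.cosh_eq θ] at h
  linarith

theorem log_two_add_exp_bounds (θ : ℝ) :
    θ ^ 2 / 4 - θ ^ 4 / 32 ≤ Real.log ((2 + Real.exp θ + Real.exp (-θ)) / 4) ∧
      Real.log ((2 + Real.exp θ + Real.exp (-θ)) / 4) ≤ θ ^ 2 / 4 + θ ^ 4 / 24 := by
  rw [two_add_exp_add_exp_neg_div_four, Real.log_pow]
  have hlower := sq_div_two_sub_le_log_cosh (θ / 2)
  have hupper := log_cosh_le_sq_div_two (θ / 2)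
  have hnonneg : 0 ≤ θ ^ 4 := by positivity
  push_cast
  constructor <;> linarith

theorem log_four_mul_mul_one_sub {p : ℝ} (hp : 0 < p) (hp' : p < 1) :
    Real.log (4 * p * (1 - p)) =
      -Real.log ((2 + Real.exp (Real.log (p / (1 - p))) +
        Real.exp (-Real.log (p / (1 - p)))) / 4) := by
  have hq : 0 < 1 - p := sub_pos.2 hp'
  rw [Real.exp_neg, Real.exp_log (div_pos hp hq), ← Real.log_inv]
  congr 1
  have h : (2 + p / (1 - p) + (p / (1 - p))⁻¹) / 4 = (4 * p * (1 - p))⁻¹ := by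
    field_simp
    ring
  rw [h, inv_inv]

/-- For every real `θ`, `θ²/4 − θ⁴/32 ≤ log((2 + e^θ + e^{−θ})/4) ≤ θ²/4 + θ⁴/24`;
equivalently, for `p ∈ (0,1)`, `q = 1 − p`, `θ = log(p/q)`:
`−θ²/4 − θ⁴/24 ≤ log(4pq) ≤ −θ²/4 + θ⁴/32`. -/
theorem log_cosh_bounds :
    (∀ θ : ℝ,
      θ ^ 2 / 4 - θ ^ 4 / 32 ≤ Real.log ((2 + Real.exp θ + Real.exp (-θ)) / 4) ∧
      Real.log ((2 + Real.exp θ + Real.exp (-θ)) / 4) ≤ θ ^ 2 / 4 + θ ^ 4 / 24) ∧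
    (∀ p : ℝ, 0 < p → p < 1 →
      -(Real.log (p / (1 - p))) ^ 2 / 4 - (Real.log (p / (1 - p))) ^ 4 / 24 ≤
          Real.log (4 * p * (1 - p)) ∧
      Real.log (4 * p * (1 - p)) ≤
          -(Real.log (p / (1 - p))) ^ 2 / 4 + (Real.log (p / (1 - p))) ^ 4 / 32) := by
  refine ⟨log_two_add_exp_bounds, fun p hp hp' => ?_⟩
  rw [log_four_mul_mul_one_sub hp hp']
  have h := log_two_add_exp_bounds (Real.log (p / (1 - p)))
  constructor <;> linarith [h.1, h.2]
end

section
/- Let f be a nonnegative integrable function on [0, 1], let k ≥ 0 and 0 ≤ ℓ < 2^k be integers, let I_{k,ℓ} = [ℓ/2^k, (ℓ+1)/2^k), and suppose f_{k,ℓ} := 2^k·∫_{I_{k,ℓ}} f > 0. Then with h_{k,ℓ} := 2^k·∫_{I_{k,ℓ}} √f, one has 0 ≤ √(f_{k,ℓ}) − h_{k,ℓ} ≤ 2^{k−1}·f_{k,ℓ}^{−3/2}·∫_{I_{k,ℓ}} (f − f_{k,ℓ})². -/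
open MeasureTheory

/-- The dyadic interval `I_{k,ℓ} = [ℓ/2^k, (ℓ+1)/2^k)`. -/
noncomputable def dyadicI (k ℓ : ℕ) : Set ℝ :=
  Set.Ico ((ℓ : ℝ) / 2 ^ k) (((ℓ : ℝ) + 1) / 2 ^ k)

/-- The local average `f_{k,ℓ} = 2^k ∫_{I_{k,ℓ}} f`. -/
noncomputable def dyadicAvg (f : ℝ → ℝ) (k ℓ : ℕ) : ℝ :=
  2 ^ k * ∫ x in dyadicI k ℓ, f x

/-- The Haar basis function `φ_{k,ℓ} = 2^{k/2} (1_{I_{k+1,2ℓ}} − 1_{I_{k+1,2ℓ+1}})`. -/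
noncomputable def haarFn (k ℓ : ℕ) (x : ℝ) : ℝ :=
  (2 : ℝ) ^ ((k : ℝ) / 2) *
    (Set.indicator (dyadicI (k + 1) (2 * ℓ)) (fun _ => (1 : ℝ)) x -
      Set.indicator (dyadicI (k + 1) (2 * ℓ + 1)) (fun _ => (1 : ℝ)) x)

/-- The Haar coefficient `θ_{k,ℓ} = ∫ f φ_{k,ℓ}`. -/
noncomputable def haarCoeff (f : ℝ → ℝ) (k ℓ : ℕ) : ℝ :=
  ∫ x in Set.Ico (0 : ℝ) 1, f x * haarFn k ℓ x

theorem dyadicI_subset_Icc {k ℓ : ℕ} (hℓ : ℓ < 2 ^ k) : dyadicI k ℓ ⊆ Set.Icc 0 1 := by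
  intro x hx
  have h : (ℓ : ℝ) + 1 ≤ 2 ^ k := by exact_mod_cast hℓ
  refine ⟨le_trans (by positivity) hx.1, hx.2.le.trans ?_⟩
  rwa [div_le_one (by positivity)]

theorem measureReal_dyadicI (k ℓ : ℕ) : volume.real (dyadicI k ℓ) = (2 ^ k)⁻¹ := by
  rw [dyadicI, Real.volume_real_Ico_of_le (by gcongr; linarith)]
  ring

theorem MeasureTheory.Integrable.sqrt {α : Type*} [MeasurableSpace α] {μ : Measure α}
    [IsFiniteMeasure μ] {f : α → ℝ} (hf : Integrable f μ) :
    Integrable (fun x => Real.sqrt (f x)) μ := by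
  refine ((integrable_const (1 : ℝ)).add hf.norm).mono'
    (Real.continuous_sqrt.comp_aestronglyMeasurable hf.1) (ae_of_all _ fun x => ?_)
  simp only [Pi.add_apply, Real.norm_eq_abs, abs_of_nonneg (Real.sqrt_nonneg _)]
  rw [Real.sqrt_le_iff]
  have h := abs_nonneg (f x)
  exact ⟨by positivity, by nlinarith [le_abs_self (f x)]⟩

/-- The gap between the tangent line of `√` at `a` and `√` itself, evaluated at `y`. -/
theorem sqrt_tangent_sub_sqrt {a y : ℝ} (ha : 0 < a) (hy : 0 ≤ y) :
    Real.sqrt a + (y - a) / (2 * Real.sqrt a) - Real.sqrt y =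
      (Real.sqrt y - Real.sqrt a) ^ 2 / (2 * Real.sqrt a) := by
  have hs : 0 < Real.sqrt a := Real.sqrt_pos.2 ha
  field_simp
  linear_combination -Real.sq_sqrt hy + Real.sq_sqrt ha.le

theorem sqrt_tangent_sub_sqrt_le {a y : ℝ} (ha : 0 < a) (hy : 0 ≤ y) :
    Real.sqrt a + (y - a) / (2 * Real.sqrt a) - Real.sqrt y ≤
      a ^ (-(3 / 2) : ℝ) / 2 * (y - a) ^ 2 := by
  have hs : 0 < Real.sqrt a := Real.sqrt_pos.2 ha
  have hpow : a ^ (-(3 / 2) : ℝ) = (a * Real.sqrt a)⁻¹ := by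
    rw [Real.rpow_neg ha.le, Real.sqrt_eq_rpow, ← Real.rpow_one_add' ha.le (by norm_num)]
    norm_num
  have hfac : (y - a) ^ 2 =
      (Real.sqrt y - Real.sqrt a) ^ 2 * (Real.sqrt y + Real.sqrt a) ^ 2 := by
    rw [← mul_pow, mul_comm, ← sq_sub_sq, Real.sq_sqrt hy, Real.sq_sqrt ha.le]
  have hle : a ≤ (Real.sqrt y + Real.sqrt a) ^ 2 := by
    nlinarith [Real.sq_sqrt ha.le, Real.sqrt_nonneg y]
  rw [sqrt_tangent_sub_sqrt ha hy, hpow, hfac]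
  calc (Real.sqrt y - Real.sqrt a) ^ 2 / (2 * Real.sqrt a)
      = (a * Real.sqrt a)⁻¹ / 2 * ((Real.sqrt y - Real.sqrt a) ^ 2 * a) := by field_simp
    _ ≤ _ := by gcongr

theorem sqrt_avg_sub_avg_sqrt_eq {f : ℝ → ℝ} {k ℓ : ℕ} (hf : IntegrableOn f (dyadicI k ℓ)) :
    Real.sqrt (dyadicAvg f k ℓ) - dyadicAvg (fun x => Real.sqrt (f x)) k ℓ =
      2 ^ k * ∫ x in dyadicI k ℓ, (Real.sqrt (dyadicAvg f k ℓ) +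
        (f x - dyadicAvg f k ℓ) / (2 * Real.sqrt (dyadicAvg f k ℓ)) - Real.sqrt (f x)) := by
  have : IsFiniteMeasure (volume.restrict (dyadicI k ℓ)) := by
    unfold dyadicI; infer_instance
  have hc (c : ℝ) : Integrable (fun _ : ℝ => c) (volume.restrict (dyadicI k ℓ)) :=
    integrable_const c
  have hI : ∫ x in dyadicI k ℓ, f x = (2 ^ k)⁻¹ * dyadicAvg f k ℓ := by
    simp [dyadicAvg]
  have hd : Integrable (fun x => (f x - dyadicAvg f k ℓ) /
      (2 * Real.sqrt (dyadicAvg f k ℓ))) (volume.restrict (dyadicI k ℓ)) :=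
    (hf.sub (hc _)).div_const _
  have hadd : Integrable (fun x => Real.sqrt (dyadicAvg f k ℓ) + (f x - dyadicAvg f k ℓ) /
      (2 * Real.sqrt (dyadicAvg f k ℓ))) (volume.restrict (dyadicI k ℓ)) := (hc _).add hd
  rw [integral_sub hadd (Integrable.sqrt hf), integral_add (hc _) hd,
    integral_div, integral_sub hf (hc _), hI]
  simp only [setIntegral_const, measureReal_dyadicI, smul_eq_mul, sub_self, zero_div, add_zero]
  rw [mul_sub, mul_inv_cancel_left₀ (by positivity)]
  rfl

/-- For a nonnegative integrable `f` on `[0,1]` with `f_{k,ℓ} = 2^k ∫_{I_{k,ℓ}} f > 0`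
and `h_{k,ℓ} = 2^k ∫_{I_{k,ℓ}} √f`, one has
`0 ≤ √f_{k,ℓ} − h_{k,ℓ} ≤ 2^{k−1} f_{k,ℓ}^{−3/2} ∫_{I_{k,ℓ}} (f − f_{k,ℓ})²`. -/
theorem sqrt_avg_sub_avg_sqrt_bound (f : ℝ → ℝ)
    (hf : IntegrableOn f (Set.Icc 0 1)) (hf0 : ∀ x ∈ Set.Icc (0 : ℝ) 1, 0 ≤ f x)
    (k ℓ : ℕ) (hℓ : ℓ < 2 ^ k)
    (hpos : 0 < dyadicAvg f k ℓ) :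
    0 ≤ Real.sqrt (dyadicAvg f k ℓ) - dyadicAvg (fun x => Real.sqrt (f x)) k ℓ ∧
    ENNReal.ofReal
        (Real.sqrt (dyadicAvg f k ℓ) - dyadicAvg (fun x => Real.sqrt (f x)) k ℓ) ≤
      ENNReal.ofReal ((2 : ℝ) ^ k / 2 * dyadicAvg f k ℓ ^ (-(3 / 2) : ℝ)) *
        ∫⁻ x in dyadicI k ℓ, ENNReal.ofReal ((f x - dyadicAvg f k ℓ) ^ 2) := by
  have hsub := dyadicI_subset_Icc hℓ
  have hfI : IntegrableOn f (dyadicI k ℓ) := hf.mono_set hsub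
  have hmeas : MeasurableSet (dyadicI k ℓ) := measurableSet_Ico
  have : IsFiniteMeasure (volume.restrict (dyadicI k ℓ)) := by
    unfold dyadicI; infer_instance
  rw [sqrt_avg_sub_avg_sqrt_eq hfI]
  set a := dyadicAvg f k ℓ
  have hg0 : ∀ x ∈ dyadicI k ℓ,
      0 ≤ Real.sqrt a + (f x - a) / (2 * Real.sqrt a) - Real.sqrt (f x) := by
    intro x hx
    rw [sqrt_tangent_sub_sqrt hpos (hf0 x (hsub hx))]
    positivity
  have hg : IntegrableOn
      (fun x => Real.sqrt a + (f x - a) / (2 * Real.sqrt a) - Real.sqrt (f x)) (dyadicI k ℓ) :=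
    ((integrable_const _).add ((hfI.sub (integrable_const _)).div_const _)).sub
      (Integrable.sqrt hfI)
  refine ⟨mul_nonneg (by positivity) (setIntegral_nonneg hmeas hg0), ?_⟩
  have hc : (0 : ℝ) ≤ a ^ (-(3 / 2) : ℝ) / 2 := by positivity
  rw [ENNReal.ofReal_mul (by positivity),
    ofReal_integral_eq_lintegral_ofReal hg (ae_restrict_of_forall_mem hmeas hg0),
    div_mul_eq_mul_div, mul_div_assoc, ENNReal.ofReal_mul (by positivity), mul_assoc,
    ← lintegral_const_mul' (ENNReal.ofReal (a ^ (-(3 / 2) : ℝ) / 2)) _ ENNReal.ofReal_ne_top]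
  refine mul_le_mul' le_rfl (setLIntegral_mono' hmeas fun x hx => ?_)
  rw [← ENNReal.ofReal_mul hc]
  exact ENNReal.ofReal_le_ofReal (sqrt_tangent_sub_sqrt_le hpos (hf0 x (hsub hx)))
end
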